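/- For every f ∈ BV(I) and m-a.e. ω ∈ Ω, the sequence n ↦ inf_{x ∈ D_{σ^n(ω),n}} 𝓛_ω^n f(x)/𝓛_ω^n 1_{I_ω}(x) is nondecreasing in n and bounded above by ‖f‖_∞; hence the limit Λ_ω(f) := lim_{n→∞} inf_{x ∈ D_{σ^n(ω),n}} 𝓛_ω^n f(x)/𝓛_ω^n 1_{I_ω}(x) exists and satisfies −‖f‖_∞ ≤ inf f ≤ Λ_ω(f) ≤ ‖f‖_∞. -/

import Mathlib

open MeasureTheory Set Filter Topology

noncomputable section

namespace RandomOpenDyn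

/-- Sup-norm of `f` over the set `A`. -/
def supNormOn (A : Set ℝ) (f : ℝ → ℝ) : ℝ := ⨆ x : A, |f (x : ℝ)|

/-- Supremum of `f` over the set `A`. -/
def supOn (A : Set ℝ) (f : ℝ → ℝ) : ℝ := ⨆ x : A, f (x : ℝ)

/-- Infimum of `f` over the set `A`. -/
def infOn (A : Set ℝ) (f : ℝ → ℝ) : ℝ := ⨅ x : A, f (x : ℝ)

/-- Total variation of `f` on `A` (as a real number). -/
def varOn (A : Set ℝ) (f : ℝ → ℝ) : ℝ := (eVariationOn f A).toReal

/-- `f` has bounded variation on `A`. -/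
def BVOn (A : Set ℝ) (f : ℝ → ℝ) : Prop := BoundedVariationOn f A

/-- Transfer operator with weight `g`, summing over preimages (in `A`) of the point `x`. -/
def transferOp (A : Set ℝ) (T : ℝ → ℝ) (g : ℝ → ℝ) (f : ℝ → ℝ) (x : ℝ) : ℝ :=
  ∑' y : {y : ℝ // y ∈ A ∧ T y = x}, g (y : ℝ) * f (y : ℝ)

/-- Iterates (along the base map `σ`) of a cocycle of operators. -/
def cocycleIter {Ω : Type*} (σ : Ω → Ω) (L : Ω → (ℝ → ℝ) → ℝ → ℝ) (ω : Ω) :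
    ℕ → (ℝ → ℝ) → ℝ → ℝ
  | 0 => fun f => f
  | n + 1 => fun f => L (σ^[n] ω) (cocycleIter σ L ω n f)

/-- Maximal length of a chain of pairwise-distinct elements of `C` in which consecutive
elements are contiguous. -/
def chainBound (C : Set (Set ℝ)) (contig : Set ℝ → Set ℝ → Prop) : ℕ :=
  sSup {k | ∃ c : ℕ → Set ℝ, Set.InjOn c (Set.Iio k) ∧ (∀ i < k, c i ∈ C) ∧
    ∀ i, i + 1 < k → contig (c i) (c (i + 1))}

/-- Raw data of a random open dynamical system: the base probability space with the
invertible driving map `σ`, the compact interval `[a,b]`, the random maps `T`, the random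
partitions of monotonicity `Z`, the random potential `φ`, the closed conformal random
measure `νc`, and the hole `H`. -/
structure RawData (Ω : Type*) [MeasurableSpace Ω] where
  m : Measure Ω
  σ : Ω → Ω
  σinv : Ω → Ω
  a : ℝ
  b : ℝ
  T : Ω → ℝ → ℝ
  Z : Ω → Finset (Set ℝ)
  φ : Ω → ℝ → ℝ
  νc : Ω → Measure ℝ
  H : Set (Ω × ℝ)

namespace RawData

variable {Ω : Type*} [MeasurableSpace Ω] (S : RawData Ω)

/-- The compact interval `I = [a,b]`. -/
def I : Set ℝ := Icc S.a S.b

/-- The weight `g_{ω,c} = exp (φ_{ω,c})`. -/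
def g (ω : Ω) (x : ℝ) : ℝ := Real.exp (S.φ ω x)

/-- The closed transfer operator `𝓛_{ω,c}`. -/
def Lc (ω : Ω) : (ℝ → ℝ) → ℝ → ℝ := transferOp S.I (S.T ω) (S.g ω)

/-- Iterates `𝓛_{ω,c}^n` of the closed transfer operators. -/
def LcIter : Ω → ℕ → (ℝ → ℝ) → ℝ → ℝ := cocycleIter S.σ S.Lc

/-- The closed conformal eigenvalue `λ_{ω,c} = ν_{σ(ω),c}(𝓛_{ω,c} 1)`. -/
def lamc (ω : Ω) : ℝ := ∫ x, S.Lc ω (fun _ => (1 : ℝ)) x ∂(S.νc (S.σ ω))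

/-- The product `λ_{ω,c}^n = ∏_{j<n} λ_{σ^j(ω),c}`. -/
def lamcProd (ω : Ω) (n : ℕ) : ℝ := ∏ j ∈ Finset.range n, S.lamc (S.σ^[j] ω)

/-- The fiber `H_ω` of the hole. -/
def Hfib (ω : Ω) : Set ℝ := {x | (ω, x) ∈ S.H}

/-- `I_ω = I \ H_ω`. -/
def Iω (ω : Ω) : Set ℝ := S.I \ S.Hfib ω

/-- The indicator function `𝟙_ω = 1_{I_ω}`. -/
def one (ω : Ω) : ℝ → ℝ := (S.Iω ω).indicator fun _ => (1 : ℝ)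

/-- The open transfer operator `𝓛_ω f = 𝓛_{ω,c}(f · 1_{I_ω})`. -/
def L (ω : Ω) (f : ℝ → ℝ) : ℝ → ℝ := S.Lc ω ((S.Iω ω).indicator f)

/-- Iterates `𝓛_ω^n` of the open transfer operators. -/
def LIter : Ω → ℕ → (ℝ → ℝ) → ℝ → ℝ := cocycleIter S.σ S.L

/-- Iterated maps `T_ω^n = T_{σ^{n-1}(ω)} ∘ ⋯ ∘ T_ω`. -/
def Tn (ω : Ω) : ℕ → ℝ → ℝ
  | 0 => fun x => x
  | n + 1 => fun x => S.T (S.σ^[n] ω) (Tn ω n x)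

/-- The survivor set `X_{ω,n} = ⋂_{j=0}^n T_ω^{-j}(I_{σ^j(ω)})`. -/
def Xn (ω : Ω) (n : ℕ) : Set ℝ :=
  ⋂ j ∈ Finset.range (n + 1), S.Tn ω j ⁻¹' S.Iω (S.σ^[j] ω)

/-- The surviving set `X_{ω,∞}`. -/
def Xinf (ω : Ω) : Set ℝ := ⋂ n, S.Xn ω n

/-- The set `D_{ω,n} = {x ∈ I : 𝓛_{σ^{-n}(ω)}^n 1_{I_{σ^{-n}(ω)}}(x) ≠ 0}`. -/
def Dn (ω : Ω) (n : ℕ) : Set ℝ :=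
  {x | x ∈ S.I ∧ S.LIter (S.σinv^[n] ω) n (S.one (S.σinv^[n] ω)) x ≠ 0}

/-- `D_{ω,∞} = ⋂_n D_{ω,n}`. -/
def Dinf (ω : Ω) : Set ℝ := ⋂ n, S.Dn ω n

/-- The sequence `n ↦ inf_{x ∈ D_{σ^n(ω),n}} 𝓛_ω^n f(x) / 𝓛_ω^n 1_{I_ω}(x)`. -/
def LamSeq (ω : Ω) (f : ℝ → ℝ) (n : ℕ) : ℝ :=
  ⨅ x : S.Dn (S.σ^[n] ω) n, S.LIter ω n f (x : ℝ) / S.LIter ω n (S.one ω) (x : ℝ)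

/-- The functional `Λ_ω(f)`, the limit of `LamSeq` (realized as a `limsup`). -/
def Lam (ω : Ω) (f : ℝ → ℝ) : ℝ := limsup (S.LamSeq ω f) atTop

/-- `ρ_ω = Λ_{σ(ω)}(𝓛_ω 1_{I_ω})`. -/
def ρ (ω : Ω) : ℝ := S.Lam (S.σ ω) (S.L ω (S.one ω))

/-- `ρ_ω^n = ∏_{j<n} ρ_{σ^j(ω)}`. -/
def ρProd (ω : Ω) (n : ℕ) : ℝ := ∏ j ∈ Finset.range n, S.ρ (S.σ^[j] ω)

/-- The iterated weight `g_ω^{(n)} = ∏_{j<n} g_{σ^j(ω)} ∘ T_ω^j`. -/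
def gn (ω : Ω) (n : ℕ) (x : ℝ) : ℝ := ∏ j ∈ Finset.range n, S.g (S.σ^[j] ω) (S.Tn ω j x)

/-- `‖g_ω^{(n)}‖_∞`, the sup of the iterated weight over `X_{ω,n-1}`. -/
def gnSup (ω : Ω) (n : ℕ) : ℝ := supNormOn (S.Xn ω (n - 1)) (S.gn ω n)

/-- The monotonicity partition `𝒵_ω^{(n)}` of `T_ω^n`. -/
def Zn (ω : Ω) (n : ℕ) : Set (Set ℝ) :=
  {P | P.Nonempty ∧ ∃ c : ℕ → Set ℝ, (∀ j < n, c j ∈ S.Z (S.σ^[j] ω)) ∧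
    P = ⋂ j ∈ Finset.range n, S.Tn ω j ⁻¹' c j}

/-- The normalized iterate `𝓛̃_ω^n f = (ρ_ω^n)⁻¹ 𝓛_ω^n f`. -/
def normLIter (ω : Ω) (n : ℕ) (f : ℝ → ℝ) (x : ℝ) : ℝ := (S.ρProd ω n)⁻¹ * S.LIter ω n f x

/-- The pullback of the holes, `⋃_{j<n} T_ω^{-j}(H_{σ^j(ω)})` (inside `I`). -/
def Hpull (ω : Ω) (n : ℕ) : Set ℝ :=
  S.I ∩ ⋃ j ∈ Finset.range n, S.Tn ω j ⁻¹' S.Hfib (S.σ^[j] ω)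

/-- Two sets are contiguous (at time `n`) if they share a boundary point or are separated
by a connected component of `⋃_{j<n} T_ω^{-j}(H_{σ^j(ω)})`. -/
def Contig (ω : Ω) (n : ℕ) (W P : Set ℝ) : Prop :=
  (closure W ∩ closure P).Nonempty ∨
    ∃ x ∈ S.Hpull ω n,
      (closure W ∩ closure (connectedComponentIn (S.Hpull ω n) x)).Nonempty ∧
        (closure (connectedComponentIn (S.Hpull ω n) x) ∩ closure P).Nonempty

/-- The good elements `𝒵_{ω,g}^{(n)}` of a refined partition `Zh`. -/
def goodZ (Zh : Ω → ℕ → Set (Set ℝ)) (ω : Ω) (n : ℕ) : Set (Set ℝ) :=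
  {P | P ∈ Zh ω n ∧ P ⊆ S.Xn ω (n - 1) ∧ 0 < S.Lam ω (P.indicator fun _ => (1 : ℝ))}

/-- The bad elements `𝒵_{ω,b}^{(n)}` of a refined partition `Zh`. -/
def badZ (Zh : Ω → ℕ → Set (Set ℝ)) (ω : Ω) (n : ℕ) : Set (Set ℝ) :=
  {P | P ∈ Zh ω n ∧ P ⊆ S.Xn ω (n - 1) ∧ S.Lam ω (P.indicator fun _ => (1 : ℝ)) = 0}

/-- `ξ_ω^{(n)}`: the maximal number of contiguous bad elements. -/
def xi (Zh : Ω → ℕ → Set (Set ℝ)) (ω : Ω) (n : ℕ) : ℕ :=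
  chainBound (S.badZ Zh ω n) (S.Contig ω n)

/-- `δ_{ω,n} = min_{Z ∈ 𝒵_{ω,g}^{(n)}} Λ_ω(1_Z)`. -/
def delta (Zh : Ω → ℕ → Set (Set ℝ)) (ω : Ω) (n : ℕ) : ℝ :=
  ⨅ P : S.goodZ Zh ω n, S.Lam ω ((P : Set ℝ).indicator fun _ => (1 : ℝ))

/-- The coarsest partition `𝒵̄_ω^{(n)}` finer than `𝒵_ω^{(n)}` whose elements are contained
in or disjoint from `X_{ω,n-1}`. -/
def Zbar (ω : Ω) (n : ℕ) : Set (Set ℝ) :=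
  {P | P.Nonempty ∧ ∃ Q ∈ S.Zn ω n, P = Q ∩ S.Xn ω (n - 1) ∨ P = Q \ S.Xn ω (n - 1)}

/-- The non-full intervals for `T_ω^n`. -/
def nonfull (ω : Ω) (n : ℕ) : Set (Set ℝ) :=
  {P | P ∈ S.Zbar ω n ∧ P ⊆ S.Xn ω (n - 1) ∧ S.Tn ω n '' P ≠ S.I}

/-- `ζ_ω^{(n)}`: the maximal number of contiguous non-full intervals for `T_ω^n`. -/
def zeta (ω : Ω) (n : ℕ) : ℕ := chainBound (S.nonfull ω n) (S.Contig ω n)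

/-- `f ∈ BV_Ω(I)`: random bounded variation functions. -/
def BVΩ (f : Ω → ℝ → ℝ) : Prop :=
  (∀ ω, BVOn S.I (f ω)) ∧ (∀ x : ℝ, Measurable fun ω => f ω x) ∧
    Measurable fun ω => supNormOn S.I (f ω)

/-- The two-sided iterates `σ^p` for `p : ℤ`. -/
def σZ (p : ℤ) (ω : Ω) : Ω := if 0 ≤ p then S.σ^[p.toNat] ω else S.σinv^[(-p).toNat] ω

/-- The standing assumptions on the closed random dynamical system with a hole:
conditions (T1)-(T3), (LIP), (GP), (A1)-(A2), (M), (C1), and the hole hypotheses. -/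
structure IsBase : Prop where
  m_prob : IsProbabilityMeasure S.m
  σ_meas : Measurable S.σ
  σinv_meas : Measurable S.σinv
  σ_left : Function.LeftInverse S.σinv S.σ
  σ_right : Function.RightInverse S.σinv S.σ
  σ_erg : Ergodic S.σ S.m
  hab : S.a < S.b
  T_meas : Measurable fun p : Ω × ℝ => S.T p.1 p.2
  T_maps : ∀ ω, MapsTo (S.T ω) S.I S.I
  T_surj : ∀ ω, SurjOn (S.T ω) S.I S.I
  Z_cover : ∀ ω, ⋃ P ∈ (S.Z ω : Set (Set ℝ)), P = S.I
  Z_disj : ∀ ω, ((S.Z ω : Set (Set ℝ))).PairwiseDisjoint id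
  Z_mono : ∀ ω, ∀ P ∈ S.Z ω,
    ContinuousOn (S.T ω) P ∧ (StrictMonoOn (S.T ω) P ∨ StrictAntiOn (S.T ω) P)
  Z_im : ∀ ω, ∀ P ∈ S.Z ω, (S.T ω '' P).OrdConnected
  Z_log_int : Integrable (fun ω => Real.log ((S.Z ω).card : ℝ)) S.m
  Z_gen : ∀ ω, ∀ A : Set ℝ, MeasurableSet A → A ⊆ S.I →
    MeasurableSet[MeasurableSpace.generateFrom {P | ∃ n, P ∈ S.Zn ω n}] A
  φ_meas : Measurable fun p : Ω × ℝ => S.φ p.1 p.2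
  φ_inf_int : Integrable (fun ω => infOn S.I (S.φ ω)) S.m
  φ_sup_int : Integrable (fun ω => supOn S.I (S.φ ω)) S.m
  g_bv : ∀ᵐ ω ∂S.m, BVOn S.I (S.g ω)
  νc_prob : ∀ ω, IsProbabilityMeasure (S.νc ω)
  νc_meas : ∀ A : Set ℝ, MeasurableSet A → Measurable fun ω => (S.νc ω A).toReal
  νc_conf : ∀ᵐ ω ∂S.m, ∀ n : ℕ, ∀ f : ℝ → ℝ, BVOn S.I f →
    ∫ x, S.LcIter ω n f x ∂(S.νc (S.σ^[n] ω)) = S.lamcProd ω n * ∫ x, f x ∂(S.νc ω)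
  lamc_log_int : Integrable (fun ω => Real.log (S.lamc ω)) S.m
  H_meas : MeasurableSet S.H
  H_pos : 0 < ∫ ω, (S.νc ω (S.Hfib ω)).toReal ∂S.m
  H_lt_one : ∫ ω, (S.νc ω (S.Hfib ω)).toReal ∂S.m < 1

/-- Condition (D): `D_{ω,∞} ≠ ∅` for m-a.e. `ω`. -/
def CondD : Prop := ∀ᵐ ω ∂S.m, (S.Dinf ω).Nonempty

/-- Admissibility of the refined partitions `𝒵̂_ω^{(n)}`:
finite partitions of `I`, finer than `𝒵_ω^{(n)}`, whose elements are contained in or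
disjoint from `X_{ω,n-1}` and on whose elements `var(g_ω^{(n)}) ≤ 2‖g_ω^{(n)}‖_∞`. -/
def ZhAdm (Zh : Ω → ℕ → Set (Set ℝ)) : Prop :=
  ∀ ω, ∀ n : ℕ, 1 ≤ n →
    (Zh ω n).Finite ∧ ⋃₀ Zh ω n = S.I ∧ (Zh ω n).PairwiseDisjoint id ∧
      ∀ P ∈ Zh ω n, P.Nonempty ∧ (∃ Q ∈ S.Zn ω n, P ⊆ Q) ∧
        (P ⊆ S.Xn ω (n - 1) ∨ Disjoint P (S.Xn ω (n - 1))) ∧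
        varOn P (S.gn ω n) ≤ 2 * S.gnSup ω n

/-- `Q_ω^{(n)} = (9 + 16 ξ_ω^{(n)}) ‖g_ω^{(n)}‖_∞ / ρ_ω^n`. -/
def Qfun (Zh : Ω → ℕ → Set (Set ℝ)) (ω : Ω) (n : ℕ) : ℝ :=
  (9 + 16 * (S.xi Zh ω n : ℝ)) * S.gnSup ω n / S.ρProd ω n

/-- Condition (Q1). -/
def CondQ1 (Zh : Ω → ℕ → Set (Set ℝ)) : Prop :=
  ∀ᵐ ω ∂S.m,
    limsup (fun n : ℕ => Real.log (S.gnSup ω n) / n) atTop +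
        limsup (fun n : ℕ => Real.log (S.xi Zh ω n : ℝ) / n) atTop <
      ∫ ω', Real.log (S.ρ ω') ∂S.m

/-- Condition (Q2). -/
def CondQ2 (Zh : Ω → ℕ → Set (Set ℝ)) : Prop :=
  ∀ n : ℕ, 1 ≤ n → Integrable (fun ω => Real.log (S.xi Zh ω n : ℝ)) S.m

/-- Condition (Q3). -/
def CondQ3 (Zh : Ω → ℕ → Set (Set ℝ)) : Prop :=
  ∀ n : ℕ, 1 ≤ n → Integrable (fun ω => Real.log (S.delta Zh ω n)) S.m

/-- `N_*`, the least `n ≥ 1` with `-∞ < ∫ log Q_ω^{(n)} dm < 0`. -/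
def Nstar (Zh : Ω → ℕ → Set (Set ℝ)) : ℕ :=
  sInf {n | 1 ≤ n ∧ Integrable (fun ω => Real.log (S.Qfun Zh ω n)) S.m ∧
    ∫ ω, Real.log (S.Qfun Zh ω n) ∂S.m < 0}

/-- `θ = -(1/N_*) ∫ log Q_ω^{(N_*)} dm`. -/
def theta (Zh : Ω → ℕ → Set (Set ℝ)) : ℝ :=
  -(1 / (S.Nstar Zh : ℝ)) * ∫ ω, Real.log (S.Qfun Zh ω (S.Nstar Zh)) ∂S.m

/-- The class `𝒟` of random BV functions with tempered variation and lower bounds. -/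
def classD (f : Ω → ℝ → ℝ) : Prop :=
  S.BVΩ f ∧ ∀ ε : ℝ, 0 < ε → ∃ V : Ω → ℝ, Measurable V ∧ (∀ ω, 0 < V ω) ∧
    ∀ ω, ∀ᶠ p : ℤ in cofinite,
      varOn S.I (f (S.σZ p ω)) ≤ V ω * Real.exp (ε * |(p : ℝ)|) ∧
        (V ω)⁻¹ * Real.exp (-(ε * |(p : ℝ)|)) ≤
          S.Lam (S.σZ p ω) fun x => |f (S.σZ p ω) x|

/-- The invariant measure `μ_ω = q_ω ν_ω` restricted to the surviving set. -/
def muMeas (ν : Ω → Measure ℝ) (q : Ω → ℝ → ℝ) (ω : Ω) : Measure ℝ :=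
  ((ν ω).restrict (S.Xinf ω)).withDensity fun x => ENNReal.ofReal (q ω x)

/-- The normalized operator `𝓛̃_ω = λ_ω⁻¹ 𝓛_ω`. -/
def tildeL (lam : Ω → ℝ) (ω : Ω) (f : ℝ → ℝ) (x : ℝ) : ℝ := (lam ω)⁻¹ * S.L ω f x

/-- Iterates of the normalized operator. -/
def tildeLIter (lam : Ω → ℝ) : Ω → ℕ → (ℝ → ℝ) → ℝ → ℝ := cocycleIter S.σ (S.tildeL lam)

/-- The fully normalized operator `𝓛̂_ω f = (λ_ω q_{σ(ω)})⁻¹ 𝓛_ω (f q_ω)`. -/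
def hatL (lam : Ω → ℝ) (q : Ω → ℝ → ℝ) (ω : Ω) (f : ℝ → ℝ) (x : ℝ) : ℝ :=
  (lam ω * q (S.σ ω) x)⁻¹ * S.L ω (fun y => f y * q ω y) x

/-- Iterates of the fully normalized operator. -/
def hatLIter (lam : Ω → ℝ) (q : Ω → ℝ → ℝ) : Ω → ℕ → (ℝ → ℝ) → ℝ → ℝ :=
  cocycleIter S.σ (S.hatL lam q)

/-- The data produced by the paper's existence theorem: the open conformal eigenvalues
`λ_ω`, the open conformal random measure `ν_ω` supported in `X_{ω,∞}`, and the invariant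
density `q_ω` with `ν_ω(q_ω) = 1` and `𝓛_ω q_ω = λ_ω q_{σ(ω)}`. -/
structure ThmAData (lam : Ω → ℝ) (ν : Ω → Measure ℝ) (q : Ω → ℝ → ℝ) : Prop where
  lam_pos : ∀ ω, 0 < lam ω
  lam_log_int : Integrable (fun ω => Real.log (lam ω)) S.m
  ν_prob : ∀ ω, IsProbabilityMeasure (ν ω)
  ν_supp : ∀ᵐ ω ∂S.m, ν ω (S.Xinf ω)ᶜ = 0
  ν_conf : ∀ᵐ ω ∂S.m, ∀ f : ℝ → ℝ, BVOn S.I f →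
    ∫ x, S.L ω f x ∂(ν (S.σ ω)) = lam ω * ∫ x, f x ∂(ν ω)
  q_bv : S.BVΩ q
  q_nonneg : ∀ ω x, 0 ≤ q ω x
  q_norm : ∀ᵐ ω ∂S.m, ∫ x, q ω x ∂(ν ω) = 1
  q_eig : ∀ᵐ ω ∂S.m, ∀ x, S.L ω (q ω) x = lam ω * q (S.σ ω) x

end RawData

/-- The raw data associated with the geometric potential `φ_{ω,c,t} = -t log |T_ω'|`,
where `Tp` denotes the derivative `T'`. -/
def geomData {Ω : Type*} [MeasurableSpace Ω] (m : Measure Ω) (σ σinv : Ω → Ω) (a b : ℝ)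
    (T : Ω → ℝ → ℝ) (Z : Ω → Finset (Set ℝ)) (H : Set (Ω × ℝ)) (Tp : Ω → ℝ → ℝ)
    (νct : ℝ → Ω → Measure ℝ) (t : ℝ) : RawData Ω :=
  ⟨m, σ, σinv, a, b, T, Z, fun ω x => -t * Real.log |Tp ω x|, νct t, H⟩

namespace RawData

variable {Ω : Type*} [MeasurableSpace Ω] {S : RawData Ω}

theorem IsBase.finite_preimage (hS : S.IsBase) (ω : Ω) (x : ℝ) :
    Finite {y : ℝ // y ∈ S.I ∧ S.T ω y = x} := by
  have hsub : {y : ℝ | y ∈ S.I ∧ S.T ω y = x} ⊆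
      ⋃ P ∈ (S.Z ω : Set (Set ℝ)), {y | y ∈ P ∧ S.T ω y = x} := by
    rintro y ⟨hy, hyx⟩
    rw [← hS.Z_cover ω] at hy
    simp only [mem_iUnion] at hy ⊢
    obtain ⟨P, hP, hyP⟩ := hy
    exact ⟨P, hP, hyP, hyx⟩
  refine Set.Finite.to_subtype (Set.Finite.subset ?_ hsub)
  refine (S.Z ω).finite_toSet.biUnion fun P hP => ?_
  have hinj : InjOn (S.T ω) P := by
    rcases (hS.Z_mono ω P hP).2 with h | h
    · exact h.injOn
    · exact h.injOn
  exact Set.Subsingleton.finite fun y hy z hz => hinj hy.1 hz.1 (hy.2.trans hz.2.symm)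

theorem L_const_mul (ω : Ω) (c : ℝ) (h : ℝ → ℝ) (x : ℝ) :
    S.L ω (fun y => c * h y) x = c * S.L ω h x := by
  simp only [L, Lc, transferOp]
  rw [← tsum_mul_left]
  refine tsum_congr fun y => ?_
  by_cases hy : (y : ℝ) ∈ S.Iω ω
  · simp only [indicator_of_mem hy]
    ring
  · simp [indicator_of_notMem hy]

theorem IsBase.L_mono (hS : S.IsBase) {ω : Ω} {h₁ h₂ : ℝ → ℝ}
    (h : ∀ y ∈ S.Iω ω, h₁ y ≤ h₂ y) (x : ℝ) : S.L ω h₁ x ≤ S.L ω h₂ x := by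
  have := hS.finite_preimage ω x
  refine Summable.tsum_le_tsum (fun y => ?_) .of_finite .of_finite
  exact mul_le_mul_of_nonneg_left (indicator_le_indicator' fun hy => h y hy) (Real.exp_pos _).le

theorem LIter_succ (ω : Ω) (n : ℕ) (f : ℝ → ℝ) :
    S.LIter ω (n + 1) f = S.L (S.σ^[n] ω) (S.LIter ω n f) := rfl

theorem one_of_mem {ω : Ω} {x : ℝ} (hx : x ∈ S.Iω ω) : S.one ω x = 1 := indicator_of_mem hx _

theorem IsBase.mul_LIter_one_le (hS : S.IsBase) {ω : Ω} {c : ℝ} {f : ℝ → ℝ}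
    (hf : ∀ x ∈ S.I, c ≤ f x) (n : ℕ) (x : ℝ) (hx : n = 0 → x ∈ S.Iω ω) :
    c * S.LIter ω n (S.one ω) x ≤ S.LIter ω n f x := by
  induction n generalizing x with
  | zero =>
    have h := hx rfl
    simpa [LIter, cocycleIter, one_of_mem h] using hf x h.1
  | succ n ih =>
    rw [LIter_succ, LIter_succ, ← L_const_mul]
    refine hS.L_mono (fun y hy => ih y ?_) x
    rintro rfl
    exact hy

theorem IsBase.LIter_le_mul_LIter_one (hS : S.IsBase) {ω : Ω} {c : ℝ} {f : ℝ → ℝ}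
    (hf : ∀ x ∈ S.I, f x ≤ c) (n : ℕ) (x : ℝ) (hx : n = 0 → x ∈ S.Iω ω) :
    S.LIter ω n f x ≤ c * S.LIter ω n (S.one ω) x := by
  induction n generalizing x with
  | zero =>
    have h := hx rfl
    simpa [LIter, cocycleIter, one_of_mem h] using hf x h.1
  | succ n ih =>
    rw [LIter_succ, LIter_succ, ← L_const_mul]
    refine hS.L_mono (fun y hy => ih y ?_) x
    rintro rfl
    exact hy

theorem IsBase.LIter_one_nonneg (hS : S.IsBase) (ω : Ω) (n : ℕ) (x : ℝ) :
    0 ≤ S.LIter ω n (S.one ω) x := by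
  cases n with
  | zero => exact indicator_nonneg (fun _ _ => zero_le_one) x
  | succ n =>
    have h₀ : ∀ y ∈ S.I, 0 ≤ S.one ω y := fun y _ => indicator_nonneg (fun _ _ => zero_le_one) y
    simpa using hS.mul_LIter_one_le h₀ (n + 1) x (by simp)

theorem IsBase.mem_Dn_iterate (hS : S.IsBase) {ω : Ω} {n : ℕ} {x : ℝ} :
    x ∈ S.Dn (S.σ^[n] ω) n ↔ x ∈ S.I ∧ S.LIter ω n (S.one ω) x ≠ 0 := by
  simp only [Dn, mem_ofPred_eq, hS.σ_left.iterate n ω]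

theorem IsBase.mem_Iω_of_mem_Dn (hS : S.IsBase) {ω : Ω} {n : ℕ} {x : ℝ}
    (hx : x ∈ S.Dn (S.σ^[n] ω) n) (hn : n = 0) : x ∈ S.Iω ω := by
  subst hn
  have h : (S.Iω ω).indicator (fun _ => (1 : ℝ)) x ≠ 0 := (hS.mem_Dn_iterate.1 hx).2
  exact mem_of_indicator_ne_zero h

theorem IsBase.LIter_one_pos (hS : S.IsBase) {ω : Ω} {n : ℕ} {x : ℝ}
    (hx : x ∈ S.Dn (S.σ^[n] ω) n) : 0 < S.LIter ω n (S.one ω) x :=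
  (hS.LIter_one_nonneg ω n x).lt_of_ne' (hS.mem_Dn_iterate.1 hx).2

theorem IsBase.le_ratio (hS : S.IsBase) {ω : Ω} {c : ℝ} {f : ℝ → ℝ}
    (hf : ∀ x ∈ S.I, c ≤ f x) (n : ℕ) (x : S.Dn (S.σ^[n] ω) n) :
    c ≤ S.LIter ω n f x / S.LIter ω n (S.one ω) x := by
  rw [le_div_iff₀ (hS.LIter_one_pos x.2)]
  exact hS.mul_LIter_one_le hf n x (hS.mem_Iω_of_mem_Dn x.2)

theorem IsBase.ratio_le (hS : S.IsBase) {ω : Ω} {c : ℝ} {f : ℝ → ℝ}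
    (hf : ∀ x ∈ S.I, f x ≤ c) (n : ℕ) (x : S.Dn (S.σ^[n] ω) n) :
    S.LIter ω n f x / S.LIter ω n (S.one ω) x ≤ c := by
  rw [div_le_iff₀ (hS.LIter_one_pos x.2)]
  exact hS.LIter_le_mul_LIter_one hf n x (hS.mem_Iω_of_mem_Dn x.2)

theorem IsBase.bddBelow_ratio (hS : S.IsBase) {ω : Ω} {c : ℝ} {f : ℝ → ℝ}
    (hf : ∀ x ∈ S.I, c ≤ f x) (n : ℕ) :
    BddBelow (range fun x : S.Dn (S.σ^[n] ω) n =>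
      S.LIter ω n f x / S.LIter ω n (S.one ω) x) :=
  ⟨c, forall_mem_range.2 (hS.le_ratio hf n)⟩

theorem IsBase.LamSeq_le (hS : S.IsBase) {ω : Ω} {c C : ℝ} {f : ℝ → ℝ}
    (hc : ∀ x ∈ S.I, c ≤ f x) (hC : ∀ x ∈ S.I, f x ≤ C) {n : ℕ}
    (hne : (S.Dn (S.σ^[n] ω) n).Nonempty) : S.LamSeq ω f n ≤ C :=
  (ciInf_le (hS.bddBelow_ratio hc n) ⟨_, hne.some_mem⟩).trans (hS.ratio_le hC n _)

theorem IsBase.le_LamSeq (hS : S.IsBase) {ω : Ω} {c : ℝ} {f : ℝ → ℝ}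
    (hc : ∀ x ∈ S.I, c ≤ f x) {n : ℕ} (hne : (S.Dn (S.σ^[n] ω) n).Nonempty) :
    c ≤ S.LamSeq ω f n := by
  have := hne.to_subtype
  exact le_ciInf (hS.le_ratio hc n)

theorem IsBase.LamSeq_mul_LIter_one_le (hS : S.IsBase) {ω : Ω} {c : ℝ} {f : ℝ → ℝ}
    (hc : ∀ x ∈ S.I, c ≤ f x) (n : ℕ) {x : ℝ} (hx : x ∈ S.Iω (S.σ^[n] ω)) :
    S.LamSeq ω f n * S.LIter ω n (S.one ω) x ≤ S.LIter ω n f x := by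
  by_cases h : S.LIter ω n (S.one ω) x = 0
  · have := hS.mul_LIter_one_le (ω := ω) hc n x (by rintro rfl; exact hx)
    simpa [h] using this
  · have hD : x ∈ S.Dn (S.σ^[n] ω) n := hS.mem_Dn_iterate.2 ⟨hx.1, h⟩
    rw [← le_div_iff₀ (hS.LIter_one_pos hD)]
    exact ciInf_le (hS.bddBelow_ratio hc n) ⟨x, hD⟩

theorem IsBase.LamSeq_monotone (hS : S.IsBase) {ω : Ω} {c : ℝ} {f : ℝ → ℝ}
    (hc : ∀ x ∈ S.I, c ≤ f x) (hne : ∀ n, (S.Dn (S.σ^[n] ω) n).Nonempty) :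
    Monotone (S.LamSeq ω f) := by
  refine monotone_nat_of_le_succ fun n => ?_
  have := (hne (n + 1)).to_subtype
  refine le_ciInf fun x => ?_
  rw [le_div_iff₀ (hS.LIter_one_pos x.2), LIter_succ, LIter_succ, ← L_const_mul]
  exact hS.L_mono (fun y hy => hS.LamSeq_mul_LIter_one_le hc n hy) x

theorem IsBase.ae_Dn_nonempty (hS : S.IsBase) (hD : S.CondD) :
    ∀ᵐ ω ∂S.m, ∀ n, (S.Dn (S.σ^[n] ω) n).Nonempty := by
  refine ae_all_iff.2 fun n => ?_
  filter_upwards [(hS.σ_erg.toMeasurePreserving.iterate n).quasiMeasurePreserving.ae hD] with ω hω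
  exact hω.mono (iInter_subset _ n)

end RawData

theorem BVOn.bddAbove_abs {A : Set ℝ} {f : ℝ → ℝ} (hf : BVOn A f) :
    BddAbove (range fun x : A => |f x|) := by
  rcases A.eq_empty_or_nonempty with rfl | ⟨y, hy⟩
  · exact ⟨0, by rintro _ ⟨x, -⟩; exact x.2.elim⟩
  · refine ⟨|f y| + varOn A f, forall_mem_range.2 fun x => ?_⟩
    have h : dist (f x) (f y) ≤ varOn A f := BoundedVariationOn.dist_le hf x.2 hy
    rw [Real.dist_eq] at h
    have := abs_sub_abs_le_abs_sub (f x) (f y)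
    linarith

/-- For every `f ∈ BV(I)` and m-a.e. `ω`, the sequence
`n ↦ inf_{x ∈ D_{σ^n(ω),n}} 𝓛_ω^n f(x)/𝓛_ω^n 1_{I_ω}(x)` is nondecreasing and bounded above
by `‖f‖_∞`; hence the limit `Λ_ω(f)` exists and `-‖f‖_∞ ≤ inf f ≤ Λ_ω(f) ≤ ‖f‖_∞`. -/
theorem statement0 {Ω : Type*} [MeasurableSpace Ω] (S : RawData Ω)
    (hS : S.IsBase) (hD : S.CondD) (f : ℝ → ℝ) (hf : BVOn S.I f) :
    ∀ᵐ ω ∂S.m,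
      Monotone (S.LamSeq ω f) ∧
      (∀ n : ℕ, S.LamSeq ω f n ≤ supNormOn S.I f) ∧
      Tendsto (S.LamSeq ω f) atTop (𝓝 (S.Lam ω f)) ∧
      -supNormOn S.I f ≤ infOn S.I f ∧
      infOn S.I f ≤ S.Lam ω f ∧ S.Lam ω f ≤ supNormOn S.I f := by
  have habs : ∀ x ∈ S.I, |f x| ≤ supNormOn S.I f := fun x hx =>
    le_ciSup hf.bddAbove_abs (⟨x, hx⟩ : S.I)
  have hlow : ∀ x ∈ S.I, -supNormOn S.I f ≤ f x := fun x hx => (abs_le.1 (habs x hx)).1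
  have hup : ∀ x ∈ S.I, f x ≤ supNormOn S.I f := fun x hx => (abs_le.1 (habs x hx)).2
  have hinf : ∀ x ∈ S.I, infOn S.I f ≤ f x := fun x hx =>
    ciInf_le (f := fun x : S.I => f x) ⟨_, forall_mem_range.2 fun x => hlow x x.2⟩ ⟨x, hx⟩
  have : Nonempty S.I := (nonempty_Icc.2 hS.hab.le).to_subtype
  filter_upwards [hS.ae_Dn_nonempty hD] with ω hne
  have hmono := hS.LamSeq_monotone hinf hne
  have hle : ∀ n, S.LamSeq ω f n ≤ supNormOn S.I f := fun n => hS.LamSeq_le hinf hup (hne n)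
  have hsup := tendsto_atTop_ciSup hmono ⟨_, forall_mem_range.2 hle⟩
  have hlim : Tendsto (S.LamSeq ω f) atTop (𝓝 (S.Lam ω f)) := by
    rwa [RawData.Lam, hsup.limsup_eq]
  exact ⟨hmono, hle, hlim, le_ciInf fun x => hlow x x.2,
    ge_of_tendsto' hlim fun n => hS.le_LamSeq hinf (hne n), le_of_tendsto' hlim hle⟩

end RandomOpenDyn

end
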